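/- Let β ∈ (-1, 0), Λ ≥ 0, δ > 0, let a : D → ℝ be bounded and continuous, and set u₀(z) = a(z) + β ln|z| on D \ {0}. Suppose u : (0, δ] × D → ℝ is smooth, satisfies the conformal Ricci flow equation ∂u/∂t = e^{-2u} Δu on (0, δ] × D, satisfies ∂u/∂t ≤ Λ everywhere (curvature bounded below by -Λ), and u(t, ·) → u₀ locally uniformly on D \ {0} as t → 0. Then for every M < ∞ there exist ρ > 0 and δ₁ ∈ (0, δ] such that u(t, z) ≥ M for all z with |z| < ρ and all t ∈ (0, δ₁). -/

import Mathlib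

open Set Metric Filter

/-- The Euclidean Laplacian of a function `f : ℂ → ℝ`, with `ℂ ≅ ℝ²`:
`Δf = ∂²f/∂x² + ∂²f/∂y²`. -/
noncomputable def laplacian (f : ℂ → ℝ) (z : ℂ) : ℝ :=
  iteratedFDeriv ℝ 2 f z ![1, 1] + iteratedFDeriv ℝ 2 f z ![Complex.I, Complex.I]

/-- The necessary second-order condition at a local minimum. -/
theorem IsLocalMin.second_deriv_nonneg {g g' : ℝ → ℝ} {x c : ℝ} (hmin : IsLocalMin g x)
    (hg : ∀ᶠ s in nhds x, HasDerivAt g (g' s) s) (hg' : HasDerivAt g' c x) : 0 ≤ c := by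
  by_contra! hc
  have hd : deriv g =ᶠ[nhds x] g' := hg.mono fun s hs => hs.deriv
  have hdd : deriv (deriv g) x = c := by rw [hd.deriv_eq, hg'.deriv]
  have hmax : IsLocalMax g x := isLocalMax_of_deriv_deriv_neg (by rw [hdd]; exact hc)
    hmin.deriv_eq_zero hg.self_of_nhds.continuousAt
  have hconst : g =ᶠ[nhds x] fun _ => g x := by
    filter_upwards [hmin, hmax] with s h1 h2 using le_antisymm h2 h1
  have : deriv (deriv g) x = 0 := by
    rw [hconst.deriv.deriv_eq]
    simp
  linarith

theorem hasDerivAt_line {E : Type*} [NormedAddCommGroup E] [NormedSpace ℝ E]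
    (z e : E) (s : ℝ) : HasDerivAt (fun s : ℝ => z + s • e) e s := by
  simpa using ((hasDerivAt_id s).smul_const e).const_add z

theorem ContDiffAt.eventually_hasDerivAt_line {E : Type*} [NormedAddCommGroup E]
    [NormedSpace ℝ E] {f : E → ℝ} {z : E} (hf : ContDiffAt ℝ 2 f z) (e : E) :
    ∀ᶠ s : ℝ in nhds 0,
      HasDerivAt (fun s : ℝ => f (z + s • e)) (fderiv ℝ f (z + s • e) e) s := by
  have hline : Tendsto (fun s : ℝ => z + s • e) (nhds 0) (nhds z) := by
    simpa using (hasDerivAt_line z e 0).continuousAt.tendsto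
  filter_upwards [hline.eventually (hf.eventually (by simp))] with s hs
  exact (hs.differentiableAt (by simp)).hasFDerivAt.comp_hasDerivAt s (hasDerivAt_line z e s)

theorem ContDiffAt.hasDerivAt_fderiv_line {E : Type*} [NormedAddCommGroup E]
    [NormedSpace ℝ E] {f : E → ℝ} {z : E} (hf : ContDiffAt ℝ 2 f z) (e : E) :
    HasDerivAt (fun s : ℝ => fderiv ℝ f (z + s • e) e) (iteratedFDeriv ℝ 2 f z ![e, e]) 0 := by
  have h1 : DifferentiableAt ℝ (fderiv ℝ f) z :=
    (hf.fderiv_right (m := 1) (by norm_num)).differentiableAt (by simp)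
  have h2 : HasFDerivAt (fderiv ℝ f) (fderiv ℝ (fderiv ℝ f) z) (z + (0 : ℝ) • e) := by
    simpa using h1.hasFDerivAt
  have h3 : HasDerivAt (fun s : ℝ => fderiv ℝ f (z + s • e)) (fderiv ℝ (fderiv ℝ f) z e) 0 :=
    h2.comp_hasDerivAt (0 : ℝ) (hasDerivAt_line z e 0)
  rw [iteratedFDeriv_two_apply]
  exact (ContinuousLinearMap.apply ℝ ℝ e).hasFDerivAt.comp_hasDerivAt (0 : ℝ) h3

/-- If `f - w` has a local minimum at `z`, the second derivative of `f` in the direction `e` is at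
least that of `w`. -/
theorem ContDiffAt.le_iteratedFDeriv_of_isLocalMin_sub {E : Type*} [NormedAddCommGroup E]
    [NormedSpace ℝ E] {f w : E → ℝ} {z e : E} {w' : ℝ → ℝ} {c : ℝ} (hf : ContDiffAt ℝ 2 f z)
    (hw : ∀ s, HasDerivAt (fun s : ℝ => w (z + s • e)) (w' s) s) (hw' : HasDerivAt w' c 0)
    (hmin : IsLocalMin (fun x => f x - w x) z) : c ≤ iteratedFDeriv ℝ 2 f z ![e, e] := by
  have hline : Tendsto (fun s : ℝ => z + s • e) (nhds 0) (nhds z) := by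
    simpa using (hasDerivAt_line z e 0).continuousAt.tendsto
  have hmin' : IsLocalMin (fun s : ℝ => f (z + s • e) - w (z + s • e)) 0 := by
    have := hline.eventually hmin
    simpa [IsLocalMin, IsMinFilter] using this
  have := hmin'.second_deriv_nonneg
    ((hf.eventually_hasDerivAt_line e).mono fun s hs => hs.sub (hw s))
    ((hf.hasDerivAt_fderiv_line e).sub hw')
  linarith

theorem hasDerivAt_sq_add_rpow {d : ℝ} (hd : 0 < d) (b p s : ℝ) :
    HasDerivAt (fun s : ℝ => ((b + s) ^ 2 + d) ^ p)
      (p * ((b + s) ^ 2 + d) ^ (p - 1) * (2 * (b + s))) s := by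
  have h1 : HasDerivAt (fun s : ℝ => (b + s) ^ 2 + d) (2 * (b + s)) s := by
    simpa using (((hasDerivAt_id s).const_add b).pow 2).add_const d
  have h2 := h1.rpow_const (p := p) (Or.inl (by positivity))
  refine h2.congr_deriv ?_
  ring

theorem hasDerivAt_deriv_sq_add_rpow {d : ℝ} (hd : 0 < d) (b p : ℝ) :
    HasDerivAt (fun s : ℝ => p * ((b + s) ^ 2 + d) ^ (p - 1) * (2 * (b + s)))
      (4 * p * (p - 1) * (b ^ 2 + d) ^ (p - 2) * b ^ 2 + 2 * p * (b ^ 2 + d) ^ (p - 1)) 0 := by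
  have h1 := (hasDerivAt_sq_add_rpow hd b (p - 1) 0).const_mul p
  have h2 : HasDerivAt (fun s : ℝ => 2 * (b + s)) 2 0 := by
    simpa using ((hasDerivAt_id (0 : ℝ)).const_add b).const_mul 2
  refine (h1.mul h2).congr_deriv ?_
  rw [show p - 1 - 1 = p - 2 by ring]
  simp only [add_zero]
  ring

/-- Comparison with the barrier `c (|z|² + ε) ^ p`, `0 < p < 1`, whose Laplacian is at least
`4 p² c (|z|² + ε) ^ (p - 1)`. -/
theorem le_laplacian_of_isLocalMin_sub_barrier {f : ℂ → ℝ} {z : ℂ} {ε p c : ℝ}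
    (hε : 0 < ε) (hp : p ∈ Ioo (0 : ℝ) 1) (hc : 0 ≤ c) (hf : ContDiffAt ℝ 2 f z)
    (hmin : IsLocalMin (fun x => f x - c * (Complex.normSq x + ε) ^ p) z) :
    4 * p ^ 2 * c * (Complex.normSq z + ε) ^ (p - 1) ≤ laplacian f z := by
  have hd1 : 0 < z.im ^ 2 + ε := by positivity
  have hd2 : 0 < z.re ^ 2 + ε := by positivity
  have h1 := hf.le_iteratedFDeriv_of_isLocalMin_sub (e := 1)
    (w := fun x => c * (Complex.normSq x + ε) ^ p)
    (fun s => by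
      refine ((hasDerivAt_sq_add_rpow hd1 z.re p s).const_mul c).congr_of_eventuallyEq
        (Eventually.of_forall fun s => ?_)
      simp only [Complex.normSq_apply]
      congr 2
      simp
      ring)
    ((hasDerivAt_deriv_sq_add_rpow hd1 z.re p).const_mul c) hmin
  have h2 := hf.le_iteratedFDeriv_of_isLocalMin_sub (e := Complex.I)
    (w := fun x => c * (Complex.normSq x + ε) ^ p)
    (fun s => by
      refine ((hasDerivAt_sq_add_rpow hd2 z.im p s).const_mul c).congr_of_eventuallyEq
        (Eventually.of_forall fun s => ?_)
      simp only [Complex.normSq_apply]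
      congr 2
      simp
      ring)
    ((hasDerivAt_deriv_sq_add_rpow hd2 z.im p).const_mul c) hmin
  have e1 : z.re ^ 2 + (z.im ^ 2 + ε) = Complex.normSq z + ε := by
    rw [Complex.normSq_apply]; ring
  have e2 : z.im ^ 2 + (z.re ^ 2 + ε) = Complex.normSq z + ε := by
    rw [Complex.normSq_apply]; ring
  rw [e1] at h1
  rw [e2] at h2
  have hs : z.re ^ 2 + z.im ^ 2 = Complex.normSq z := by rw [Complex.normSq_apply]; ring
  have hQ : 0 < Complex.normSq z + ε := by have := Complex.normSq_nonneg z; positivity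
  set Q := Complex.normSq z + ε with hQdef
  have hQp : Q ^ (p - 1) = Q ^ (p - 2) * Q := by
    rw [← Real.rpow_add_one hQ.ne']; congr 1; ring
  have hpos : 0 ≤ 4 * p * (1 - p) * c * Q ^ (p - 2) * ε := by
    have := hp.1.le
    have : 0 ≤ 1 - p := by linarith [hp.2]
    positivity
  unfold laplacian
  have key : 4 * p ^ 2 * c * Q ^ (p - 1) + 4 * p * (1 - p) * c * Q ^ (p - 2) * ε
      = c * (4 * p * (p - 1) * Q ^ (p - 2) * z.re ^ 2 + 2 * p * Q ^ (p - 1))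
        + c * (4 * p * (p - 1) * Q ^ (p - 2) * z.im ^ 2 + 2 * p * Q ^ (p - 1)) := by
    have : z.re ^ 2 = Q - ε - z.im ^ 2 := by rw [hQdef]; linarith
    rw [hQp, this]; ring
  linarith

/-- Lower bound on a disc for a function whose Laplacian is smaller than that of the barrier
`c (|z|² + ε) ^ p`. -/
theorem le_of_laplacian_lt_barrier {f : ℂ → ℝ} {r ε p c m : ℝ} (hr : 0 ≤ r) (hr1 : r ≤ 1)
    (hε : ε ∈ Ioo (0 : ℝ) 1) (hp : p ∈ Ioo (0 : ℝ) 1) (hc : 0 ≤ c)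
    (hf : ∀ z ∈ closedBall (0 : ℂ) r, ContDiffAt ℝ 2 f z)
    (hlap : ∀ z ∈ closedBall (0 : ℂ) r,
      laplacian f z < 4 * p ^ 2 * c * (Complex.normSq z + ε) ^ (p - 1))
    (hm : ∀ z ∈ sphere (0 : ℂ) r, m ≤ f z) :
    ∀ z ∈ closedBall (0 : ℂ) r, m - 2 * c ≤ f z := by
  intro z hz
  have hwcont : Continuous fun x : ℂ => c * (Complex.normSq x + ε) ^ p :=
    continuous_const.mul ((Complex.continuous_normSq.add continuous_const).rpow_const
      fun _ => Or.inr hp.1.le)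
  have hfcont : ContinuousOn f (closedBall 0 r) :=
    fun x hx => (hf x hx).continuousAt.continuousWithinAt
  obtain ⟨z₀, hz₀, hmin⟩ := (isCompact_closedBall (0 : ℂ) r).exists_isMinOn ⟨z, hz⟩
    (hfcont.sub hwcont.continuousOn)
  have hz₀s : z₀ ∈ sphere (0 : ℂ) r := by
    by_contra hns
    have hb : z₀ ∈ ball (0 : ℂ) r := by
      rw [mem_ball]
      exact lt_of_le_of_ne hz₀ hns
    have hloc : IsLocalMin (fun x => f x - c * (Complex.normSq x + ε) ^ p) z₀ :=
      hmin.isLocalMin (mem_of_superset (isOpen_ball.mem_nhds hb) ball_subset_closedBall)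
    exact (le_laplacian_of_isLocalMin_sub_barrier hε.1 hp hc (hf z₀ hz₀) hloc).not_gt
      (hlap z₀ hz₀)
  have hle : f z₀ - c * (Complex.normSq z₀ + ε) ^ p ≤ f z - c * (Complex.normSq z + ε) ^ p :=
    hmin hz
  have h0 : 0 ≤ c * (Complex.normSq z + ε) ^ p := by
    have := Complex.normSq_nonneg z
    have := hε.1
    positivity
  have h2 : (Complex.normSq z₀ + ε) ^ p ≤ 2 := by
    have hn : Complex.normSq z₀ ≤ 1 := by
      rw [Complex.normSq_eq_norm_sq, mem_sphere_zero_iff_norm.mp hz₀s]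
      exact pow_le_one₀ hr hr1
    have hn0 := Complex.normSq_nonneg z₀
    calc (Complex.normSq z₀ + ε) ^ p ≤ 2 ^ p :=
          Real.rpow_le_rpow (by linarith [hε.1]) (by linarith [hε.2]) hp.1.le
      _ ≤ 2 ^ (1 : ℝ) := Real.rpow_le_rpow_of_exponent_le (by norm_num) hp.2.le
      _ = 2 := Real.rpow_one 2
  have := hm z₀ hz₀s
  nlinarith [mul_le_mul_of_nonneg_left h2 hc]

/-- A bounded function that is at most `L |z| ^ (2 b)`, where `b < 0`, is dominated by a multiple of
`(|z|² + ε) ^ b` for small `ε`. -/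
theorem exists_forall_lt_regularized_rpow {S : Set ℂ} {G : ℂ → ℝ} {b L N : ℝ}
    (hb : b ∈ Ioo (-1 : ℝ) 0) (hL : 0 ≤ L)
    (hG : ∀ z ∈ S, z ≠ 0 → G z ≤ L * Complex.normSq z ^ b) (hN : ∀ z ∈ S, G z ≤ N) :
    ∃ ε ∈ Ioo (0 : ℝ) 1, ∀ z ∈ S, G z < (2 * L + 1) * (Complex.normSq z + ε) ^ b := by
  have h2 : Tendsto (fun ε : ℝ => 2 * ε) (nhdsWithin 0 (Ioi 0)) (nhdsWithin 0 (Ioi 0)) := by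
    refine tendsto_nhdsWithin_iff.mpr ⟨?_, ?_⟩
    · exact Tendsto.mono_left (by simpa using (continuous_const_mul (2 : ℝ)).tendsto 0)
        nhdsWithin_le_nhds
    · filter_upwards [self_mem_nhdsWithin] with ε hε
      simpa using hε
  have hlarge : ∀ᶠ ε : ℝ in nhdsWithin 0 (Ioi 0), max N 0 < (2 * ε) ^ b :=
    ((tendsto_rpow_neg_nhdsGT_zero hb.2).comp h2).eventually_gt_atTop _
  have hsmall : ∀ᶠ ε : ℝ in nhdsWithin 0 (Ioi 0), ε ∈ Ioo (0 : ℝ) 1 :=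
    Ioo_mem_nhdsGT one_pos
  obtain ⟨ε, hε, hεI⟩ := (hlarge.and hsmall).exists
  refine ⟨ε, hεI, fun z hz => ?_⟩
  have hε0 := hεI.1
  have hn := Complex.normSq_nonneg z
  have hpos : 0 < (Complex.normSq z + ε) ^ b := by positivity
  rcases lt_or_ge (Complex.normSq z) ε with hlt | hge
  · have h3 : (2 * ε) ^ b ≤ (Complex.normSq z + ε) ^ b :=
      Real.rpow_le_rpow_of_nonpos (by positivity) (by linarith) hb.2.le
    have h4 := hN z hz
    have h5 := le_max_left N 0
    have := mul_nonneg hL hpos.le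
    linarith
  · have hz0 : 0 < Complex.normSq z := hε0.trans_le hge
    have h3 : (2 * Complex.normSq z) ^ b ≤ (Complex.normSq z + ε) ^ b :=
      Real.rpow_le_rpow_of_nonpos (by positivity) (by linarith) hb.2.le
    rw [Real.mul_rpow (by norm_num) hn] at h3
    have h4 : (1 / 2 : ℝ) ≤ 2 ^ b := by
      calc (1 / 2 : ℝ) = 2 ^ (-1 : ℝ) := by rw [Real.rpow_neg_one]; norm_num
        _ ≤ 2 ^ b := Real.rpow_le_rpow_of_exponent_le (by norm_num) hb.1.le
    have h5 := hG z hz (Complex.normSq_pos.mp hz0)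
    have h6 : 0 ≤ Complex.normSq z ^ b := by positivity
    have h7 : Complex.normSq z ^ b ≤ 2 * (Complex.normSq z + ε) ^ b := by nlinarith
    nlinarith [mul_le_mul_of_nonneg_left h7 hL]

/-- A function whose derivative is at most `Λ` exceeds its limit at `0⁺` by at most `Λ t`. -/
theorem le_add_mul_of_hasDerivAt_le {f f' : ℝ → ℝ} {Λ δ l : ℝ}
    (hf : ∀ t ∈ Ioc (0 : ℝ) δ, HasDerivAt f (f' t) t) (hf' : ∀ t ∈ Ioc (0 : ℝ) δ, f' t ≤ Λ)
    (hl : Tendsto f (nhdsWithin 0 (Ioi 0)) (nhds l)) :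
    ∀ t ∈ Ioc (0 : ℝ) δ, f t ≤ l + Λ * t := by
  intro t ht
  have hd : ∀ τ ∈ Ioc (0 : ℝ) δ, HasDerivAt (fun τ => f τ - Λ * τ) (f' τ - Λ) τ :=
    fun τ hτ => (hf τ hτ).sub (hasDerivAt_const_mul Λ)
  have hanti : AntitoneOn (fun τ => f τ - Λ * τ) (Ioc 0 δ) := by
    refine antitoneOn_of_deriv_nonpos (convex_Ioc 0 δ)
      (fun τ hτ => (hd τ hτ).continuousAt.continuousWithinAt)
      (fun τ hτ => (hd τ (interior_subset hτ)).differentiableAt.differentiableWithinAt)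
      fun τ hτ => ?_
    rw [(hd τ (interior_subset hτ)).deriv]
    linarith [hf' τ (interior_subset hτ)]
  have hid : Tendsto (fun τ : ℝ => Λ * τ) (nhdsWithin 0 (Ioi 0)) (nhds 0) :=
    Tendsto.mono_left (by simpa using (continuous_const_mul Λ).tendsto 0) nhdsWithin_le_nhds
  have hlim : Tendsto (fun τ => f τ - Λ * τ) (nhdsWithin 0 (Ioi 0)) (nhds l) := by
    simpa using hl.sub hid
  have : f t - Λ * t ≤ l := by
    refine ge_of_tendsto hlim ?_
    filter_upwards [Ioc_mem_nhdsGT ht.1] with τ hτ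
    exact hanti ⟨hτ.1, hτ.2.trans ht.2⟩ ht hτ.2
  linarith

/-- Let `β ∈ (-1,0)`, `Λ ≥ 0`, `δ > 0`, `a : D → ℝ` bounded and continuous,
and `u₀(z) = a(z) + β ln|z|` on `D \ {0}`.  Suppose `u : (0,δ] × D → ℝ` is smooth, satisfies
the conformal Ricci flow equation `∂u/∂t = e^{-2u}Δu` on `(0,δ] × D`, satisfies `∂u/∂t ≤ Λ`
everywhere (curvature bounded below by `-Λ`), and `u(t,·) → u₀` locally uniformly on
`D \ {0}` as `t → 0`.  Then for every `M < ∞` there exist `ρ > 0` and `δ₁ ∈ (0,δ]` such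
that `u(t,z) ≥ M` for all `z` with `|z| < ρ` and all `t ∈ (0,δ₁)`. -/
theorem conformal_factor_large_near_cone_point
    (β Λ δ : ℝ) (hβ : β ∈ Ioo (-1 : ℝ) 0) (hΛ : 0 ≤ Λ) (hδ : 0 < δ)
    (a : ℂ → ℝ) (ha_bdd : ∃ C : ℝ, ∀ z ∈ ball (0 : ℂ) 1, |a z| ≤ C)
    (ha_cont : ContinuousOn a (ball (0 : ℂ) 1))
    (u₀ : ℂ → ℝ) (hu₀ : ∀ z ∈ ball (0 : ℂ) 1 \ {0}, u₀ z = a z + β * Real.log ‖z‖)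
    (u : ℝ → ℂ → ℝ)
    (hsmooth : ContDiffOn ℝ ((⊤ : ℕ∞) : WithTop ℕ∞)
      (fun p : ℝ × ℂ => u p.1 p.2) (Ioc 0 δ ×ˢ ball (0 : ℂ) 1))
    (hflow : ∀ t ∈ Ioc (0 : ℝ) δ, ∀ z ∈ ball (0 : ℂ) 1,
      HasDerivAt (fun τ => u τ z) (Real.exp (-2 * u t z) * laplacian (u t) z) t)
    (hcurv : ∀ t ∈ Ioc (0 : ℝ) δ, ∀ z ∈ ball (0 : ℂ) 1,
      Real.exp (-2 * u t z) * laplacian (u t) z ≤ Λ)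
    (hconv : TendstoLocallyUniformlyOn (fun t => u t) u₀
      (nhdsWithin 0 (Ioi 0)) (ball (0 : ℂ) 1 \ {0})) :
    ∀ M : ℝ, ∃ ρ ∈ Ioc (0 : ℝ) 1, ∃ δ₁ ∈ Ioc (0 : ℝ) δ,
      ∀ t ∈ Ioo (0 : ℝ) δ₁, ∀ z ∈ ball (0 : ℂ) ρ, M ≤ u t z := by
  intro M
  obtain ⟨C, hC⟩ := ha_bdd
  have hpunct : ∀ z ∈ ball (0 : ℂ) 1, z ≠ 0 → z ∈ ball (0 : ℂ) 1 \ {0} :=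
    fun z hz hz0 => ⟨hz, by simpa using hz0⟩
  set L : ℝ := Λ * Real.exp (2 * (C + Λ * δ)) with hLdef
  have hL : 0 ≤ L := by positivity
  set p : ℝ := β + 1 with hpdef
  have hp : p ∈ Ioo (0 : ℝ) 1 := ⟨by linarith [hβ.1], by linarith [hβ.2]⟩
  have hp0 := hp.1
  set c : ℝ := (2 * L + 1) / (4 * p ^ 2) with hcdef
  have hc : 0 ≤ c := by positivity
  have hpc : 4 * p ^ 2 * c = 2 * L + 1 := by
    rw [hcdef]; field_simp
  have hupper : ∀ t ∈ Ioc (0 : ℝ) δ, ∀ z ∈ ball (0 : ℂ) 1, z ≠ 0 →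
      u t z ≤ C + Λ * δ + β * Real.log ‖z‖ := by
    intro t ht z hz hz0
    have h1 := le_add_mul_of_hasDerivAt_le (fun τ hτ => hflow τ hτ z hz)
      (fun τ hτ => hcurv τ hτ z hz) (hconv.tendsto_at (hpunct z hz hz0)) t ht
    rw [hu₀ z (hpunct z hz hz0)] at h1
    linarith [(abs_le.mp (hC z hz)).2, mul_le_mul_of_nonneg_left ht.2 hΛ]
  have hlap : ∀ t ∈ Ioc (0 : ℝ) δ, ∀ z ∈ ball (0 : ℂ) 1,
      laplacian (u t) z ≤ Λ * Real.exp (2 * u t z) := by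
    intro t ht z hz
    have h1 := mul_le_mul_of_nonneg_right (hcurv t ht z hz) (Real.exp_pos (2 * u t z)).le
    have h2 : Real.exp (-2 * u t z) * Real.exp (2 * u t z) = 1 := by
      rw [← Real.exp_add]; simp
    linear_combination h1 + (-laplacian (u t) z) * h2
  have hlap' : ∀ t ∈ Ioc (0 : ℝ) δ, ∀ z ∈ ball (0 : ℂ) 1, z ≠ 0 →
      laplacian (u t) z ≤ L * Complex.normSq z ^ β := by
    intro t ht z hz hz0
    refine (hlap t ht z hz).trans ?_
    rw [hLdef, Real.rpow_def_of_pos (Complex.normSq_pos.mpr hz0), mul_assoc, ← Real.exp_add,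
      Complex.normSq_eq_norm_sq, Real.log_pow]
    refine mul_le_mul_of_nonneg_left (Real.exp_le_exp.mpr ?_) hΛ
    push_cast
    linarith [hupper t ht z hz hz0]
  have hspace : ∀ t ∈ Ioc (0 : ℝ) δ, ∀ z ∈ ball (0 : ℂ) 1, ContDiffAt ℝ 2 (u t) z := by
    intro t ht z hz
    have h1 : ContDiffOn ℝ ((⊤ : ℕ∞) : WithTop ℕ∞) (u t) (ball (0 : ℂ) 1) :=
      hsmooth.comp (contDiff_prodMk_right t).contDiffOn fun x hx => ⟨ht, hx⟩
    exact (h1.contDiffAt (isOpen_ball.mem_nhds hz)).of_le (WithTop.coe_le_coe.mpr le_top)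
  obtain ⟨r, hrlog, hr0, hr1⟩ :
      ∃ r : ℝ, M + C + 1 + 2 * c ≤ β * Real.log r ∧ 0 < r ∧ r < 1 := by
    have h1 : Tendsto (fun r => β * Real.log r) (nhdsWithin 0 (Ioi 0)) atTop :=
      Real.tendsto_log_nhdsGT_zero.const_mul_atBot_of_neg hβ.2
    exact ((h1.eventually_ge_atTop _).and (Ioo_mem_nhdsGT (one_pos (α := ℝ)))).exists
  have hsub : closedBall (0 : ℂ) r ⊆ ball 0 1 := closedBall_subset_ball hr1
  have hsphere : ∀ z ∈ sphere (0 : ℂ) r, z ∈ ball (0 : ℂ) 1 \ {0} := fun z hz =>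
    hpunct z (hsub (sphere_subset_closedBall hz)) (ne_zero_of_mem_sphere hr0.ne' ⟨z, hz⟩)
  have hunif : TendstoUniformlyOn (fun t => u t) u₀ (nhdsWithin 0 (Ioi 0)) (sphere (0 : ℂ) r) :=
    (tendstoLocallyUniformlyOn_iff_tendstoUniformlyOn_of_compact (isCompact_sphere 0 r)).mp
      (hconv.mono hsphere)
  obtain ⟨η, hη0, hη⟩ :=
    mem_nhdsGT_iff_exists_Ioo_subset.mp (Metric.tendstoUniformlyOn_iff.mp hunif 1 one_pos)
  refine ⟨r, ⟨hr0, hr1.le⟩, min δ η, ⟨lt_min hδ hη0, min_le_left _ _⟩, fun t ht z hz => ?_⟩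
  have htδ : t ∈ Ioc (0 : ℝ) δ := ⟨ht.1, (ht.2.trans_le (min_le_left _ _)).le⟩
  have hbdry : ∀ x ∈ sphere (0 : ℂ) r, M + 2 * c ≤ u t x := by
    intro x hx
    have h1 : dist (u₀ x) (u t x) < 1 := hη ⟨ht.1, ht.2.trans_le (min_le_right _ _)⟩ x hx
    rw [Real.dist_eq, hu₀ x (hsphere x hx), mem_sphere_zero_iff_norm.mp hx] at h1
    linarith [(abs_lt.mp h1).2, (abs_le.mp (hC x (hsphere x hx).1)).1]
  have hcont : ContinuousOn (fun x => Λ * Real.exp (2 * u t x)) (closedBall (0 : ℂ) r) := by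
    intro x hx
    have := (hspace t htδ x (hsub hx)).continuousAt
    exact (continuousAt_const.mul (continuousAt_const.mul this).rexp).continuousWithinAt
  obtain ⟨N, hN⟩ := (isCompact_closedBall (0 : ℂ) r).bddAbove_image hcont
  obtain ⟨ε, hε, hlt⟩ := exists_forall_lt_regularized_rpow (S := closedBall (0 : ℂ) r) hβ hL
    (fun x hx => hlap' t htδ x (hsub hx))
    (fun x hx => (hlap t htδ x (hsub hx)).trans (hN (mem_image_of_mem _ hx)))
  have := le_of_laplacian_lt_barrier hr0.le hr1.le hε hp hc
    (fun x hx => hspace t htδ x (hsub hx))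
    (fun x hx => by
      rw [hpc, show p - 1 = β by rw [hpdef]; ring]
      exact hlt x hx) hbdry z (ball_subset_closedBall hz)
  linarith
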